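/- Let S be an available system, T a deterministic target behavior, G_{S,T} the composition plant, and let V be a nonblocking supervisor for G_{S,T} with Lm(V/G_{S,T}) = K↑_{S,T} = supC(Lm(G_{S,T})). Then every exact composition P of T in S is induced by V along its induced runs: for every target trace τ of T and every h ∈ H_{P,τ} with |h| < |τ|, letting a = a_{|h|+1} be the next action of τ, it holds that P(h, a) ∈ V(word(h)·a). -/

import Mathlib

open Classical

/-! ### Behaviors, systems, histories, traces (AI behavior composition) -/

/-- A behavior: a transition system with an initial state over actions `Act`. -/
structure Behavior (State : Type) (Act : Type) where
  init : State
  trans : State → Act → State → Prop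

/-- A behavior is deterministic if successors are unique. -/
def Behavior.Deterministic {State Act : Type} (B : Behavior State Act) : Prop :=
  ∀ s a s' s'', B.trans s a s' → B.trans s a s'' → s' = s''

/-- The initial state of the enacted system of `S = (B_1, ..., B_n)`. -/
def sysInit {n : ℕ} {SB Act : Type} (S : Fin n → Behavior SB Act) : Fin n → SB :=
  fun i => (S i).init

/-- Enacted-system transition `b −a,j→ b'`. -/
def sysTrans {n : ℕ} {SB Act : Type} (S : Fin n → Behavior SB Act)
    (b : Fin n → SB) (a : Act) (j : Fin n) (b' : Fin n → SB) : Prop :=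
  (S j).trans (b j) a (b' j) ∧ ∀ i, i ≠ j → b i = b' i

/-- One step of a system history: action, delegated index, and resulting system state. -/
abbrev Step (SB Act : Type) (n : ℕ) := Act × Fin n × (Fin n → SB)

/-- Last system state of a history (initial state for the empty history). -/
def lastState {n : ℕ} {SB Act : Type} (S : Fin n → Behavior SB Act)
    (h : List (Step SB Act n)) : Fin n → SB :=
  match h.getLast? with
  | none => sysInit S
  | some s => s.2.2

/-- `h` is a system history: a finite sequence of consecutive enacted-system
transitions starting from the initial system state. -/
inductive ValidHist {n : ℕ} {SB Act : Type} (S : Fin n → Behavior SB Act) :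
    List (Step SB Act n) → Prop
  | nil : ValidHist S []
  | snoc {h : List (Step SB Act n)} {a : Act} {j : Fin n} {b : Fin n → SB} :
      ValidHist S h → sysTrans S (lastState S h) a j b → ValidHist S (h ++ [(a, j, b)])

/-- A (finite or infinite) trace of a behavior `B`, starting at the initial state:
`acts i` is the (i+1)-st action, leading from `states i` to `states (i+1)`,
for all `i <` the length `len : ℕ∞`. -/
structure Trace {State Act : Type} (B : Behavior State Act) where
  len : ℕ∞
  states : ℕ → State
  acts : ℕ → Act
  init_eq : states 0 = B.init
  step : ∀ i : ℕ, (i : ℕ∞) < len → B.trans (states i) (acts i) (states (i + 1))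

/-- The set `H_{P,τ}` of `(P,τ)`-induced system histories, for an
action-request controller `P`. -/
inductive Induced {n : ℕ} {SB ST Act : Type} (S : Fin n → Behavior SB Act)
    {T : Behavior ST Act} (P : List (Step SB Act n) → Act → Fin n) (τ : Trace T) :
    List (Step SB Act n) → Prop
  | nil : Induced S P τ []
  | snoc {h : List (Step SB Act n)} {j : Fin n} {b : Fin n → SB} :
      Induced S P τ h → (h.length : ℕ∞) < τ.len →
      j = P h (τ.acts h.length) →
      sysTrans S (lastState S h) (τ.acts h.length) j b →
      Induced S P τ (h ++ [(τ.acts h.length, j, b)])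

/-- `P` realizes the target trace `τ` in system `S`. -/
def Realizes {n : ℕ} {SB ST Act : Type} (S : Fin n → Behavior SB Act)
    {T : Behavior ST Act} (P : List (Step SB Act n) → Act → Fin n) (τ : Trace T) : Prop :=
  ∀ h, Induced S P τ h → (h.length : ℕ∞) < τ.len →
    ∃ b', sysTrans S (lastState S h) (τ.acts h.length) (P h (τ.acts h.length)) b'

/-- `P` is an exact composition of the target `T` in system `S`. -/
def ExactComposition {n : ℕ} {SB ST Act : Type} (S : Fin n → Behavior SB Act)
    (T : Behavior ST Act) (P : List (Step SB Act n) → Act → Fin n) : Prop :=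
  ∀ τ : Trace T, Realizes S P τ

/-- `R` is an nd-simulation of the target `T` by the enacted system of `S`. -/
def IsNDSim {n : ℕ} {SB ST Act : Type} (T : Behavior ST Act)
    (S : Fin n → Behavior SB Act) (R : ST → (Fin n → SB) → Prop) : Prop :=
  ∀ t b, R t b → ∀ a t', T.trans t a t' →
    ∃ j : Fin n, (∃ b', sysTrans S b a j b') ∧ ∀ b', sysTrans S b a j b' → R t' b'

/-- `t ≼_ND b` : `(t,b)` belongs to some nd-simulation. -/
def NDSimulated {n : ℕ} {SB ST Act : Type} (T : Behavior ST Act)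
    (S : Fin n → Behavior SB Act) (t : ST) (b : Fin n → SB) : Prop :=
  ∃ R, IsNDSim T S R ∧ R t b

/-! ### Generators and supervisory control -/

/-- A generator (deterministic automaton with partial transition function,
marked states, and a distinguished set of controllable events; the
uncontrollable events are the complement). -/
structure Generator (E : Type) (Q : Type) where
  controllable : Set E
  init : Q
  step : Q → E → Option Q
  marked : Set Q

/-- Run a generator from a state on a word. -/
def Generator.runFrom {E Q : Type} (G : Generator E Q) : Q → List E → Option Q
  | q, [] => some q
  | q, σ :: w =>
    match G.step q σ with
    | none => none
    | some q' => G.runFrom q' w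

/-- Run a generator from its initial state. -/
def Generator.run {E Q : Type} (G : Generator E Q) (w : List E) : Option Q :=
  G.runFrom G.init w

/-- The generated language `L(G)`. -/
def Generator.Lang {E Q : Type} (G : Generator E Q) : Set (List E) :=
  { w | (G.run w).isSome }

/-- The marked language `Lm(G)`. -/
def Generator.MLang {E Q : Type} (G : Generator E Q) : Set (List E) :=
  { w | ∃ q, G.run w = some q ∧ q ∈ G.marked }

/-- Prefix closure of a language. -/
def cl {E : Type} (K : Set (List E)) : Set (List E) := { w | ∃ v, w ++ v ∈ K }

/-- A language is closed if it equals its prefix closure. -/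
def IsClosedLang {E : Type} (K : Set (List E)) : Prop := K = cl K

/-- `K` is controllable in `G`: `cl(K)·Σu ∩ L(G) ⊆ cl(K)`. -/
def ControllableIn {E Q : Type} (G : Generator E Q) (K : Set (List E)) : Prop :=
  ∀ w σ, w ∈ cl K → σ ∉ G.controllable → w ++ [σ] ∈ G.Lang → w ++ [σ] ∈ cl K

/-- A supervisor for `G`: enables a set of events after each generated word,
always including all uncontrollable events. -/
def IsSupervisor {E Q : Type} (G : Generator E Q) (V : List E → Set E) : Prop :=
  ∀ w ∈ G.Lang, ∀ σ, σ ∉ G.controllable → σ ∈ V w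

/-- The controlled language `L(V/G)` (as an inductive predicate: the smallest
language containing ε and closed under enabled extensions). -/
inductive CtrlLang {E Q : Type} (G : Generator E Q) (V : List E → Set E) : List E → Prop
  | nil : CtrlLang G V []
  | snoc {w : List E} {σ : E} :
      CtrlLang G V w → w ++ [σ] ∈ G.Lang → σ ∈ V w → CtrlLang G V (w ++ [σ])

/-- `L(V/G)` as a set. -/
def ctrlLang {E Q : Type} (G : Generator E Q) (V : List E → Set E) : Set (List E) :=
  { w | CtrlLang G V w }

/-- `Lm(V/G) = L(V/G) ∩ Lm(G)`. -/
def mCtrlLang {E Q : Type} (G : Generator E Q) (V : List E → Set E) : Set (List E) :=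
  ctrlLang G V ∩ G.MLang

/-- `V` is nonblocking in `G`. -/
def Nonblocking {E Q : Type} (G : Generator E Q) (V : List E → Set E) : Prop :=
  ctrlLang G V = cl (mCtrlLang G V)

/-- The supremal controllable sublanguage of `K` in `G`: the union of all
controllable sublanguages of `K`. -/
def supC {E Q : Type} (G : Generator E Q) (K : Set (List E)) : Set (List E) :=
  ⋃₀ { K' | K' ⊆ K ∧ ControllableIn G K' }

/-! ### The composition plant -/

/-- Events of the composition plant: target actions, behavior indexes, behavior states. -/
abbrev PlantEvent (SB Act : Type) (n : ℕ) := Act ⊕ (Fin n ⊕ SB)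

/-- States of the composition plant: target state, system state, pending request
(`none` = `e`), pending delegation (`none` = `0`). -/
abbrev PlantState (SB ST Act : Type) (n : ℕ) :=
  ST × (Fin n → SB) × Option Act × Option (Fin n)

/-- The composition plant `G_{S,T}`. -/
noncomputable def compPlant {n : ℕ} {SB ST Act : Type}
    (S : Fin n → Behavior SB Act) (T : Behavior ST Act) :
    Generator (PlantEvent SB Act n) (PlantState SB ST Act n) where
  controllable := { σ | ∃ j : Fin n, σ = Sum.inr (Sum.inl j) }
  init := (T.init, sysInit S, none, none)
  step := fun q σ =>
    match q.2.2.1, q.2.2.2, σ with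
    | none, none, Sum.inl a =>
        if h : ∃ t', T.trans q.1 a t' then some (h.choose, q.2.1, some a, none) else none
    | some a, none, Sum.inr (Sum.inl j) => some (q.1, q.2.1, some a, some j)
    | some a, some j, Sum.inr (Sum.inr s) =>
        if (S j).trans (q.2.1 j) a s then some (q.1, Function.update q.2.1 j s, none, none)
        else none
    | _, _, _ => none
  marked := { q | q.2.2.1 = none ∧ q.2.2.2 = none }

/-- The word of a system history: each step `(a, j, b)` contributes
`a · j · st_j(b)`. -/
def histWord {n : ℕ} {SB Act : Type} (h : List (Step SB Act n)) :
    List (PlantEvent SB Act n) :=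
  h.foldr
    (fun s acc =>
      Sum.inl s.1 :: Sum.inr (Sum.inl s.2.1) :: Sum.inr (Sum.inr (s.2.2 s.2.1)) :: acc) []

/-- A controller `P` is induced by a supervisor `V` for the composition plant:
`P(h,σ) ∈ V(word(h)·σ)` for every system history `h` and action `σ`. -/
def InducedBySupervisor {n : ℕ} {SB Act : Type} (S : Fin n → Behavior SB Act)
    (V : List (PlantEvent SB Act n) → Set (PlantEvent SB Act n))
    (P : List (Step SB Act n) → Act → Fin n) : Prop :=
  ∀ h, ValidHist S h → ∀ a : Act,
    Sum.inr (Sum.inl (P h a)) ∈ V (histWord h ++ [Sum.inl a])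

/-- Words of shape `(A_t · Indx · Succ)*`. -/
inductive TriWord {n : ℕ} {SB Act : Type} : List (PlantEvent SB Act n) → Prop
  | nil : TriWord []
  | cons {a : Act} {j : Fin n} {s : SB} {w : List (PlantEvent SB Act n)} :
      TriWord w → TriWord (Sum.inl a :: Sum.inr (Sum.inl j) :: Sum.inr (Sum.inr s) :: w)

/-- The selection function `ω` of the DES controller generator extracted from the
generator `R` (with `dec` decoding composition states from `R`-states):
`ω(q, σ)` is the set of indexes `j` such that some reachable `R`-state decoding
to `q` has an outgoing `σ·j·b'` run. -/
def cgOmega {n : ℕ} {SB ST Act Y : Type} (R : Generator (PlantEvent SB Act n) Y)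
    (dec : Y → ST × (Fin n → SB)) (q : ST × (Fin n → SB)) (σ : Act) : Set (Fin n) :=
  { j | ∃ y s, (∃ p, TriWord p ∧ R.run p = some y) ∧ dec y = q ∧
      (R.runFrom y [Sum.inl σ, Sum.inr (Sum.inl j), Sum.inr (Sum.inr s)]).isSome }

/-- A controller `P` is generated by the DES controller generator extracted
from `R`: all its delegations are allowed by `ω` at the decoded composition
state reached by the word of the current history. -/
def GeneratedBy {n : ℕ} {SB ST Act Y : Type} (S : Fin n → Behavior SB Act)
    (R : Generator (PlantEvent SB Act n) Y) (dec : Y → ST × (Fin n → SB))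
    (P : List (Step SB Act n) → Act → Fin n) : Prop :=
  ∀ h, ValidHist S h → ∀ σ : Act, ∀ y, R.run (histWord h) = some y →
    P h σ ∈ cgOmega R dec (dec y) σ

/-! ### Simulation, RTFs and the maximal composition plant -/

/-- `B2 ≼ B1` : a simulation of `B2` by `B1` relating their initial states. -/
def Simulates {S2 S1 Act : Type} (B2 : Behavior S2 Act) (B1 : Behavior S1 Act) : Prop :=
  ∃ R : S2 → S1 → Prop,
    (∀ s2 s1, R s2 s1 → ∀ a s2', B2.trans s2 a s2' → ∃ s1', B1.trans s1 a s1' ∧ R s2' s1') ∧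
    R B2.init B1.init

/-- The induced histories `H_{P,τ}` for a transition-request controller `P`. -/
inductive TInduced {n : ℕ} {SB ST' Act : Type} (S : Fin n → Behavior SB Act)
    {T' : Behavior ST' Act} (P : List (Step SB Act n) → ST' × Act × ST' → Fin n)
    (τ : Trace T') : List (Step SB Act n) → Prop
  | nil : TInduced S P τ []
  | snoc {h : List (Step SB Act n)} {j : Fin n} {b : Fin n → SB} :
      TInduced S P τ h → (h.length : ℕ∞) < τ.len →
      j = P h (τ.states h.length, τ.acts h.length, τ.states (h.length + 1)) →
      sysTrans S (lastState S h) (τ.acts h.length) j b →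
      TInduced S P τ (h ++ [(τ.acts h.length, j, b)])

/-- A transition-request controller `P` realizes the trace `τ`. -/
def TRealizes {n : ℕ} {SB ST' Act : Type} (S : Fin n → Behavior SB Act)
    {T' : Behavior ST' Act} (P : List (Step SB Act n) → ST' × Act × ST' → Fin n)
    (τ : Trace T') : Prop :=
  ∀ h, TInduced S P τ h → (h.length : ℕ∞) < τ.len →
    ∃ b', sysTrans S (lastState S h) (τ.acts h.length)
      (P h (τ.states h.length, τ.acts h.length, τ.states (h.length + 1))) b'

/-- `P` is an exact composition of the (possibly nondeterministic) target `T'`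
in `S`, with transition requests. -/
def TExactComposition {n : ℕ} {SB ST' Act : Type} (S : Fin n → Behavior SB Act)
    (T' : Behavior ST' Act) (P : List (Step SB Act n) → ST' × Act × ST' → Fin n) : Prop :=
  ∀ τ : Trace T', TRealizes S P τ

/-- `T'` is a realizable target fragment (RTF) of `T` in `S`. -/
def IsRTF {n : ℕ} {SB ST ST' Act : Type} (S : Fin n → Behavior SB Act)
    (T : Behavior ST Act) (T' : Behavior ST' Act) : Prop :=
  Simulates T' T ∧ ∃ P, TExactComposition S T' P

/-- `T'` is a supremal realizable target fragment (SRTF) of `T` in `S`. -/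
def IsSRTF {n : ℕ} {SB ST ST' Act : Type} (S : Fin n → Behavior SB Act)
    (T : Behavior ST Act) (T' : Behavior ST' Act) : Prop :=
  IsRTF S T T' ∧ ∀ (ST'' : Type) (T'' : Behavior ST'' Act), IsRTF S T T'' →
    Simulates T' T'' → Simulates T'' T'

/-- Events of the maximal composition plant: target transitions and behavior indexes. -/
abbrev MaxEvent (ST Act : Type) (n : ℕ) := (ST × Act × ST) ⊕ Fin n

/-- States of the maximal composition plant. -/
abbrev MaxState (SB ST Act : Type) (n : ℕ) := ST × (Fin n → SB) × Option (ST × Act × ST)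

/-- The maximal composition plant `Ĝ_{S,T}` (for a deterministic system `S`);
all events are controllable. -/
noncomputable def maxPlant {n : ℕ} {SB ST Act : Type}
    (S : Fin n → Behavior SB Act) (T : Behavior ST Act) :
    Generator (MaxEvent ST Act n) (MaxState SB ST Act n) where
  controllable := Set.univ
  init := (T.init, sysInit S, none)
  step := fun q σ =>
    match q.2.2, σ with
    | none, Sum.inl θ =>
        if T.trans θ.1 θ.2.1 θ.2.2 then some (q.1, q.2.1, some θ) else none
    | some θ, Sum.inr j =>
        if h : θ.1 = q.1 ∧ ∃ s', (S j).trans (q.2.1 j) θ.2.1 s' then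
          some (θ.2.2, Function.update q.2.1 j h.2.choose, none)
        else none
    | _, _ => none
  marked := { q | q.2.2 = none }

/-- `MaxWordH T t h w tf` : `w` is the word `(θ1·j1)⋯(θℓ·jℓ)` of history `h`,
where `θi` is the transition of `T` on the i-th action of `h` from the `T`-state
reached so far (starting at `t`), and `tf` is the final `T`-state reached. -/
inductive MaxWordH {n : ℕ} {SB ST Act : Type} (T : Behavior ST Act) :
    ST → List (Step SB Act n) → List (MaxEvent ST Act n) → ST → Prop
  | nil {t : ST} : MaxWordH T t [] [] t
  | cons {t t' tf : ST} {a : Act} {j : Fin n} {b : Fin n → SB}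
      {rest : List (Step SB Act n)} {w : List (MaxEvent ST Act n)} :
      T.trans t a t' → MaxWordH T t' rest w tf →
      MaxWordH T t ((a, j, b) :: rest) (Sum.inl (t, a, t') :: Sum.inr j :: w) tf

/-- The extracted target `T*_{S,T}` from a generator `R` for `K̂↑`: states are
`R`-states, with a transition on action `a` whenever `R` can run a request
`θ = (t,a,t') ∈ δ_t` followed by a delegation `j`. -/
def extractedTarget {n : ℕ} {ST Act Y : Type} (T : Behavior ST Act)
    (R : Generator (MaxEvent ST Act n) Y) : Behavior Y Act where
  init := R.init
  trans := fun y a y' => ∃ (t t' : ST) (j : Fin n),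
    T.trans t a t' ∧ R.runFrom y [Sum.inl (t, a, t'), Sum.inr j] = some y'

/-- Running a generator on a concatenation of words. -/
theorem Generator.runFrom_append {E Q : Type} (G : Generator E Q) (q : Q) (u v : List E) :
    G.runFrom q (u ++ v) = (G.runFrom q u).bind fun q' => G.runFrom q' v := by
  induction u generalizing q with
  | nil => rfl
  | cons σ u ih =>
    simp only [List.cons_append, Generator.runFrom]
    cases G.step q σ with
    | none => rfl
    | some q' => exact ih q'

theorem Generator.run_append {E Q : Type} (G : Generator E Q) {u : List E} {q : Q}
    (hu : G.run u = some q) (v : List E) : G.run (u ++ v) = G.runFrom q v := by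
  rw [Generator.run, Generator.runFrom_append, ← Generator.run, hu, Option.bind_some]

theorem cl_mono {E : Type} {K L : Set (List E)} (hKL : K ⊆ L) : cl K ⊆ cl L :=
  fun _ ⟨v, hv⟩ => ⟨v, hKL hv⟩

/-- A language that contains `K` and is stable under dropping the last letter contains `cl K`. -/
theorem mem_of_mem_cl {E : Type} {K : Set (List E)} {C : List E → Prop}
    (hK : ∀ w ∈ K, C w) (hC : ∀ w σ, C (w ++ [σ]) → C w) {w : List E} (hw : w ∈ cl K) : C w := by
  obtain ⟨v, hv⟩ := hw
  have key := hK _ hv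
  clear hv
  induction v using List.reverseRecOn with
  | nil => simpa using key
  | append_singleton v σ ih => exact ih (hC _ σ (by simpa using key))

/-- The last event of a nonempty controlled word is enabled by the supervisor. -/
theorem CtrlLang.mem_of_append_singleton {E Q : Type} {G : Generator E Q} {V : List E → Set E}
    {w : List E} {σ : E} (h : CtrlLang G V (w ++ [σ])) : σ ∈ V w := by
  generalize hu : w ++ [σ] = u at h
  cases h with
  | nil => simp at hu
  | snoc _ _ hσ =>
    obtain ⟨rfl, hs⟩ := List.append_inj' hu rfl
    obtain rfl : σ = _ := by simpa using hs
    exact hσ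

section CompositionRuns

variable {n : ℕ} {SB ST Act : Type}

@[simp]
theorem lastState_append_singleton (S : Fin n → Behavior SB Act) (h : List (Step SB Act n))
    (s : Step SB Act n) : lastState S (h ++ [s]) = s.2.2 := by
  simp [lastState]

@[simp]
theorem histWord_append_singleton (h : List (Step SB Act n)) (s : Step SB Act n) :
    histWord (h ++ [s]) =
      histWord h ++ [Sum.inl s.1, Sum.inr (Sum.inl s.2.1), Sum.inr (Sum.inr (s.2.2 s.2.1))] := by
  induction h with
  | nil => rfl
  | cons x h ih => simpa [histWord] using ih

/-- `ControlledRun S T P h t`: the history `h` arises when the controller `P` serves requests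
along a run of the target `T` that ends in `t`. -/
inductive ControlledRun (S : Fin n → Behavior SB Act) (T : Behavior ST Act)
    (P : List (Step SB Act n) → Act → Fin n) : List (Step SB Act n) → ST → Prop
  | nil : ControlledRun S T P [] T.init
  | snoc {h : List (Step SB Act n)} {t t' : ST} {a : Act} {b : Fin n → SB} :
      ControlledRun S T P h t → T.trans t a t' → sysTrans S (lastState S h) a (P h a) b →
      ControlledRun S T P (h ++ [(a, P h a, b)]) t'

variable {S : Fin n → Behavior SB Act} {T : Behavior ST Act}
  {P : List (Step SB Act n) → Act → Fin n}

theorem Induced.controlledRun {τ : Trace T} {h : List (Step SB Act n)} (hh : Induced S P τ h) :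
    ControlledRun S T P h (τ.states h.length) := by
  induction hh with
  | nil => rw [List.length_nil, τ.init_eq]; exact .nil
  | snoc _ hlt hj hb ih =>
    subst hj
    rw [List.length_append, List.length_singleton]
    exact ih.snoc (τ.step _ hlt) hb

/-- Whether a history is induced by a trace depends only on the actions it covers. -/
theorem Induced.congr {τ τ' : Trace T} {h : List (Step SB Act n)} (hh : Induced S P τ h)
    (hlen : (h.length : ℕ∞) ≤ τ'.len) (hacts : ∀ i < h.length, τ'.acts i = τ.acts i) :
    Induced S P τ' h := by
  induction hh with
  | nil => exact .nil
  | @snoc h j b _ _ hj hb ih =>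
    simp only [List.length_append, List.length_singleton] at hlen hacts
    have hlt : (h.length : ℕ∞) < τ'.len :=
      lt_of_lt_of_le (by exact_mod_cast Nat.lt_succ_self _) hlen
    have ha := hacts h.length (Nat.lt_succ_self _)
    rw [← ha] at hj hb ⊢
    exact .snoc (ih hlt.le fun i hi => hacts i (Nat.lt_succ_of_lt hi)) hlt hj hb

/-- Truncate a trace after `k` steps and append one further target transition. -/
noncomputable def Trace.extend (τ : Trace T) (k : ℕ) (hk : (k : ℕ∞) ≤ τ.len) {a : Act} {t' : ST}
    (ht : T.trans (τ.states k) a t') : Trace T where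
  len := (k + 1 : ℕ)
  states := Function.update τ.states (k + 1) t'
  acts := Function.update τ.acts k a
  init_eq := by rw [Function.update_of_ne (by omega), τ.init_eq]
  step i hi := by
    have hi : i < k + 1 := by exact_mod_cast hi
    rw [Function.update_of_ne (by omega)]
    obtain rfl | hne := eq_or_ne i k
    · simpa using ht
    · rw [Function.update_of_ne hne, Function.update_of_ne (by omega)]
      exact τ.step i (lt_of_lt_of_le (by exact_mod_cast (by omega : i < k)) hk)

theorem Induced.extend {τ : Trace T} {h : List (Step SB Act n)} (hh : Induced S P τ h)
    (hk : (h.length : ℕ∞) ≤ τ.len) {a : Act} {t' : ST}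
    (ht : T.trans (τ.states h.length) a t') : Induced S P (τ.extend h.length hk ht) h :=
  hh.congr (by simp [Trace.extend]) fun _ hi => Function.update_of_ne hi.ne _ _

/-- Every controlled run is induced by a target trace. -/
theorem ControlledRun.exists_trace [Nonempty Act] {h : List (Step SB Act n)} {t : ST}
    (hh : ControlledRun S T P h t) :
    ∃ τ : Trace T, (h.length : ℕ∞) ≤ τ.len ∧ τ.states h.length = t ∧ Induced S P τ h := by
  induction hh with
  | nil =>
    exact ⟨⟨0, fun _ => T.init, fun _ => Classical.arbitrary Act, rfl, fun i hi => by simp at hi⟩,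
      by simp, rfl, .nil⟩
  | @snoc h t t' a b _ ht hb ih =>
    obtain ⟨τ, hlen, rfl, hτ⟩ := ih
    have hacts : (τ.extend h.length hlen ht).acts h.length = a := Function.update_self ..
    refine ⟨τ.extend h.length hlen ht, by simp [Trace.extend], by simp [Trace.extend], ?_⟩
    have key := (hτ.extend hlen ht).snoc (j := P h a) (b := b)
      (by simp only [Trace.extend]; exact_mod_cast Nat.lt_succ_self _)
    rw [hacts] at key
    exact key rfl hb

/-- An exact composition can serve every request the target makes after a controlled run. -/
theorem ExactComposition.exists_sysTrans (hP : ExactComposition S T P)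
    {h : List (Step SB Act n)} {t t' : ST} {a : Act} (hh : ControlledRun S T P h t)
    (ht : T.trans t a t') : ∃ b, sysTrans S (lastState S h) a (P h a) b := by
  have : Nonempty Act := ⟨a⟩
  obtain ⟨τ, hlen, rfl, hτ⟩ := hh.exists_trace
  have hacts : (τ.extend h.length hlen ht).acts h.length = a := Function.update_self ..
  have key := hP (τ.extend h.length hlen ht) h (hτ.extend hlen ht)
    (by simp only [Trace.extend]; exact_mod_cast Nat.lt_succ_self _)
  rwa [hacts] at key

theorem compPlant_step_request (hT : T.Deterministic) {t t' : ST} {a : Act}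
    (ht : T.trans t a t') (b : Fin n → SB) :
    (compPlant S T).step (t, b, none, none) (Sum.inl a) = some (t', b, some a, none) := by
  have hex : ∃ t', T.trans t a t' := ⟨t', ht⟩
  simp only [compPlant, dif_pos hex, hT _ _ _ _ hex.choose_spec ht]

theorem compPlant_step_successor {t : ST} {a : Act} {j : Fin n} {b b' : Fin n → SB}
    (hb : sysTrans S b a j b') :
    (compPlant S T).step (t, b, some a, some j) (Sum.inr (Sum.inr (b' j))) =
      some (t, b', none, none) := by
  have hupd : Function.update b j (b' j) = b' := by
    ext i
    obtain rfl | hne := eq_or_ne i j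
    · simp
    · rw [Function.update_of_ne hne, hb.2 i hne]
  simp only [compPlant, if_pos hb.1]
  convert rfl using 4
  exact hupd.symm

theorem ControlledRun.run_histWord (hT : T.Deterministic) {h : List (Step SB Act n)} {t : ST}
    (hh : ControlledRun S T P h t) :
    (compPlant S T).run (histWord h) = some (t, lastState S h, none, none) := by
  induction hh with
  | nil => rfl
  | @snoc h t t' a b _ ht hb ih =>
    rw [histWord_append_singleton, Generator.run_append _ ih, lastState_append_singleton]
    simp only [Generator.runFrom, compPlant_step_request hT ht]
    simp only [show (compPlant S T).step (t', lastState S h, some a, none)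
      (Sum.inr (Sum.inl (P h a))) = some (t', lastState S h, some a, some (P h a)) from rfl,
      compPlant_step_successor hb]

variable (S T P) in
/-- The words of the controlled runs of `P`. -/
def runLang : Set (List (PlantEvent SB Act n)) :=
  {w | ∃ h t, ControlledRun S T P h t ∧ w = histWord h}

variable (S T P) in
/-- The words of the controlled runs of `P`, possibly followed by a request of the target, and
then possibly by the delegation chosen by `P`. -/
inductive PartialRun : List (PlantEvent SB Act n) → Prop
  | idle {h : List (Step SB Act n)} {t : ST} :
      ControlledRun S T P h t → PartialRun (histWord h)
  | request {h : List (Step SB Act n)} {t t' : ST} {a : Act} :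
      ControlledRun S T P h t → T.trans t a t' → PartialRun (histWord h ++ [Sum.inl a])
  | delegation {h : List (Step SB Act n)} {t t' : ST} {a : Act} :
      ControlledRun S T P h t → T.trans t a t' →
      PartialRun (histWord h ++ [Sum.inl a] ++ [Sum.inr (Sum.inl (P h a))])

theorem PartialRun.of_append_singleton {w : List (PlantEvent SB Act n)} {σ : PlantEvent SB Act n}
    (hw : PartialRun S T P (w ++ [σ])) : PartialRun S T P w := by
  generalize hu : w ++ [σ] = u at hw
  cases hw with
  | idle hh =>
    cases hh with
    | nil => simp [histWord] at hu
    | @snoc h t t' a b hh ht hb =>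
      rw [histWord_append_singleton, List.append_cons (histWord h),
        List.append_cons (histWord h ++ _)] at hu
      obtain ⟨rfl, -⟩ := List.append_inj' hu rfl
      exact .delegation hh ht
  | request hh ht =>
    obtain ⟨rfl, -⟩ := List.append_inj' hu rfl
    exact .idle hh
  | delegation hh ht =>
    obtain ⟨rfl, -⟩ := List.append_inj' hu rfl
    exact .request hh ht

theorem PartialRun.mem_cl_runLang (hP : ExactComposition S T P)
    {w : List (PlantEvent SB Act n)} (hw : PartialRun S T P w) : w ∈ cl (runLang S T P) := by
  cases hw with
  | idle hh => exact ⟨[], _, _, hh, List.append_nil _⟩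
  | @request h t t' a hh ht =>
    obtain ⟨b, hb⟩ := hP.exists_sysTrans hh ht
    exact ⟨[Sum.inr (Sum.inl (P h a)), Sum.inr (Sum.inr (b (P h a)))], _, _, hh.snoc ht hb,
      by simp⟩
  | @delegation h t t' a hh ht =>
    obtain ⟨b, hb⟩ := hP.exists_sysTrans hh ht
    exact ⟨[Sum.inr (Sum.inr (b (P h a)))], _, _, hh.snoc ht hb, by simp⟩

theorem partialRun_of_mem_cl_runLang {w : List (PlantEvent SB Act n)}
    (hw : w ∈ cl (runLang S T P)) : PartialRun S T P w :=
  mem_of_mem_cl (by rintro _ ⟨h, t, hh, rfl⟩; exact .idle hh)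
    (fun _ _ => PartialRun.of_append_singleton) hw

theorem runLang_subset_MLang (hT : T.Deterministic) :
    runLang S T P ⊆ (compPlant S T).MLang := by
  rintro _ ⟨h, t, hh, rfl⟩
  exact ⟨_, hh.run_histWord hT, rfl, rfl⟩

/-- Requests and successor states never leave the partial runs of `P`. -/
theorem PartialRun.append_uncontrollable (hT : T.Deterministic)
    {w : List (PlantEvent SB Act n)} {σ : PlantEvent SB Act n} (hw : PartialRun S T P w)
    (hσ : σ ∉ (compPlant S T).controllable) (hL : w ++ [σ] ∈ (compPlant S T).Lang) :
    PartialRun S T P (w ++ [σ]) := by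
  cases hw with
  | @idle h t hh =>
    rw [Generator.Lang, Set.mem_ofPred_eq, Generator.run_append _ (hh.run_histWord hT)] at hL
    rcases σ with a | j | s
    · by_cases hex : ∃ t', T.trans t a t'
      · exact .request hh hex.choose_spec
      · simp [Generator.runFrom, compPlant, hex] at hL
    · exact absurd ⟨j, rfl⟩ hσ
    · simp [Generator.runFrom, compPlant] at hL
  | @request h t t' a hh ht =>
    rw [Generator.Lang, Set.mem_ofPred_eq, List.append_assoc,
      Generator.run_append _ (hh.run_histWord hT)] at hL
    simp only [List.singleton_append, Generator.runFrom, compPlant_step_request hT ht] at hL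
    rcases σ with a' | j | s
    · simp [compPlant] at hL
    · exact absurd ⟨j, rfl⟩ hσ
    · simp [compPlant] at hL
  | @delegation h t t' a hh ht =>
    rw [Generator.Lang, Set.mem_ofPred_eq, List.append_assoc, List.append_assoc,
      Generator.run_append _ (hh.run_histWord hT)] at hL
    simp only [List.singleton_append, Generator.runFrom, compPlant_step_request hT ht] at hL
    rcases σ with a' | j | s
    · simp [compPlant] at hL
    · exact absurd ⟨j, rfl⟩ hσ
    · by_cases hs : (S (P h a)).trans (lastState S h (P h a)) a s
      · have hb : sysTrans S (lastState S h) a (P h a)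
            (Function.update (lastState S h) (P h a) s) :=
          ⟨by simpa using hs, fun i hi => (Function.update_of_ne hi _ _).symm⟩
        simpa using PartialRun.idle (hh.snoc ht hb)
      · simp [compPlant, hs] at hL

theorem controllableIn_runLang (hT : T.Deterministic) (hP : ExactComposition S T P) :
    ControllableIn (compPlant S T) (runLang S T P) := fun _ _ hw hσ hL =>
  ((partialRun_of_mem_cl_runLang hw).append_uncontrollable hT hσ hL).mem_cl_runLang hP

end CompositionRuns

/-- Completeness: given a nonblocking supervisor `V` with
`Lm(V/G_{S,T}) = K↑_{S,T}`, every exact composition `P` of `T` in `S` is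
induced by `V` along its induced runs. -/
theorem composition_completeness {n : ℕ} {SB ST Act : Type}
    [Fintype SB] [Fintype ST] [Fintype Act]
    (S : Fin n → Behavior SB Act) (T : Behavior ST Act) (hT : T.Deterministic)
    (V : List (PlantEvent SB Act n) → Set (PlantEvent SB Act n))
    (hV : IsSupervisor (compPlant S T) V)
    (hnb : Nonblocking (compPlant S T) V)
    (hm : mCtrlLang (compPlant S T) V = supC (compPlant S T) (compPlant S T).MLang)
    (P : List (Step SB Act n) → Act → Fin n) (hP : ExactComposition S T P) :
    ∀ (τ : Trace T) (h : List (Step SB Act n)), Induced S P τ h →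
      (h.length : ℕ∞) < τ.len →
      Sum.inr (Sum.inl (P h (τ.acts h.length))) ∈
        V (histWord h ++ [Sum.inl (τ.acts h.length)]) := by
  intro τ h hh hlt
  have hpart : PartialRun S T P (histWord h ++ [Sum.inl (τ.acts h.length)] ++
      [Sum.inr (Sum.inl (P h (τ.acts h.length)))]) :=
    .delegation hh.controlledRun (τ.step _ hlt)
  have hsub : runLang S T P ⊆ mCtrlLang (compPlant S T) V := by
    rw [hm]
    exact Set.subset_sUnion_of_mem ⟨runLang_subset_MLang hT, controllableIn_runLang hT hP⟩
  have hmem := cl_mono hsub (hpart.mem_cl_runLang hP)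
  rw [← hnb] at hmem
  exact CtrlLang.mem_of_append_singleton hmem
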